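/- With the setup ψ(ρ) = Cor(g_X(Z₁), g_Y(Z₂)) for nondecreasing, nondegenerate quantile transforms g_X, g_Y with finite second moments, ψ is nondecreasing on (−1,1); its derivative is ψ'(ρ) = (σ_X σ_Y)^{-1} ∬ φ₂(t,s;ρ) dμ_X(t) dμ_Y(s) ≥ 0, where μ_X, μ_Y are the Lebesgue–Stieltjes measures of g_X, g_Y and φ₂ is the bivariate standard normal density. -/

import Mathlib

open MeasureTheory ProbabilityTheory Real Set
open scoped ENNReal

/-- Bivariate standard normal density with correlation ρ. -/
noncomputable def phi2 (a b ρ : ℝ) : ℝ :=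
  (2 * Real.pi * Real.sqrt (1 - ρ ^ 2))⁻¹ *
    Real.exp (-(a ^ 2 - 2 * ρ * a * b + b ^ 2) / (2 * (1 - ρ ^ 2)))

/-- `g` times a Gaussian weight with rate `> 1/4` is Lebesgue integrable. -/
lemma g_weight_integrable (g : ℝ → ℝ) (hmon : Monotone g)
    (hL2 : Integrable (fun z => (g z) ^ 2) (gaussianReal 0 1)) (k : ℝ) (hk : 1 / 4 < k) :
    Integrable (fun z => g z * Real.exp (-k * z ^ 2)) := by
  have h1 : Integrable (fun z : ℝ => (g z) ^ 2 * Real.exp (-z ^ 2 / 2)) := by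
    rw [gaussianReal_of_var_ne_zero _ one_ne_zero,
      integrable_withDensity_iff (measurable_gaussianPDF 0 1)
        (ae_of_all _ fun x => gaussianPDF_lt_top)] at hL2
    have h2 := hL2.mul_const (√(2 * π))
    refine h2.congr (ae_of_all _ fun z => ?_)
    have hp : √(2 * π) ≠ 0 := by positivity
    simp only [toReal_gaussianPDF, gaussianPDFReal, NNReal.coe_one, mul_one, sub_zero]
    field_simp
  have h3 : Integrable (fun z : ℝ => Real.exp (-(2 * k - 1 / 2) * z ^ 2)) :=
    integrable_exp_neg_mul_sq (by linarith)
  refine (h1.add h3).mono' ?_ (ae_of_all _ fun z => ?_)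
  · exact (hmon.measurable.mul (by fun_prop)).aestronglyMeasurable
  · simp only [Pi.add_apply, norm_mul, Real.norm_eq_abs, Real.abs_exp]
    have e1 : Real.exp (-z ^ 2 / 2) = Real.exp (-z ^ 2 / 4) ^ 2 := by
      rw [← Real.exp_nat_mul]; congr 1; push_cast; ring
    have e2 : Real.exp (-(2 * k - 1 / 2) * z ^ 2) = Real.exp (-(k - 1 / 4) * z ^ 2) ^ 2 := by
      rw [← Real.exp_nat_mul]; congr 1; push_cast; ring
    have e3 : Real.exp (-k * z ^ 2) = Real.exp (-z ^ 2 / 4) * Real.exp (-(k - 1 / 4) * z ^ 2) := by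
      rw [← Real.exp_add]; congr 1; ring
    rw [e1, e2, e3, ← sq_abs (g z)]
    nlinarith [sq_nonneg (|g z| * Real.exp (-z ^ 2 / 4) - Real.exp (-(k - 1 / 4) * z ^ 2)),
      sq_nonneg (|g z| * Real.exp (-z ^ 2 / 4)), sq_nonneg (Real.exp (-(k - 1 / 4) * z ^ 2))]

lemma sigmaFinite_of_Iic (μ : Measure ℝ) (hfin : ∀ z, μ (Set.Iic z) ≠ ⊤) : SigmaFinite μ := by
  have : IsLocallyFiniteMeasure μ := by
    refine ⟨fun x => ⟨Set.Iic (x + 1), Iic_mem_nhds (by linarith), ?_⟩⟩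
    exact (hfin _).lt_top
  infer_instance

/-- The basic Fubini integrability. -/
lemma prod_indicator_integrable (g : ℝ → ℝ) (hmon : Monotone g) (μ : Measure ℝ) [SigmaFinite μ]
    (c : ℝ) (hfin : ∀ z, μ (Set.Iic z) ≠ ⊤) (hg : ∀ z, g z = c + (μ (Set.Iic z)).toReal)
    (hL2 : Integrable (fun z => (g z) ^ 2) (gaussianReal 0 1)) (k : ℝ) (hk : 1 / 4 < k)
    (h : ℝ → ℝ) (hm : Measurable h) (C : ℝ) (hb : ∀ z, |h z| ≤ C * Real.exp (-k * z ^ 2)) :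
    Integrable (fun p : ℝ × ℝ => (Set.Ici p.1).indicator h p.2) (μ.prod volume) := by
  have hI : ∀ p : ℝ × ℝ, (Set.Ici p.1).indicator h p.2
      = {q : ℝ × ℝ | q.1 ≤ q.2}.indicator (fun q => h q.2) p := by
    intro p; simp [Set.indicator]
  have hmeas : Measurable (fun p : ℝ × ℝ => (Set.Ici p.1).indicator h p.2) := by
    simp_rw [hI]
    exact (hm.comp measurable_snd).indicator (measurableSet_le measurable_fst measurable_snd)
  have hJ : ∀ y x : ℝ, (Set.Ici x).indicator h y = (Set.Iic y).indicator (fun _ => h y) x := by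
    intro y x; simp [Set.indicator]
  rw [integrable_prod_iff' hmeas.aestronglyMeasurable]
  constructor
  · refine ae_of_all _ fun y => ?_
    simp_rw [hJ]
    rw [integrable_indicator_iff measurableSet_Iic]
    exact integrableOn_const (hfin y)
  · have hval : ∀ y, ∫ x, ‖(Set.Ici x).indicator h y‖ ∂μ = (g y - c) * |h y| := by
      intro y
      have : ∀ x, ‖(Set.Ici x).indicator h y‖ = (Set.Iic y).indicator (fun _ => |h y|) x := by
        intro x; rw [hJ]; simp only [Set.indicator]; split_ifs <;> simp
      simp_rw [this]
      rw [integral_indicator measurableSet_Iic, setIntegral_const, hg]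
      simp [Measure.real]
    simp_rw [hval]
    have hgi : Integrable (fun z => (g z - c) * Real.exp (-k * z ^ 2)) := by
      have := (g_weight_integrable g hmon hL2 k hk).sub
        ((integrable_exp_neg_mul_sq (b := k) (by linarith)).const_mul c)
      refine this.congr (ae_of_all _ fun z => ?_)
      simp only [Pi.sub_apply]; ring
    refine (hgi.const_mul C).mono' ?_ (ae_of_all _ fun z => ?_)
    · exact ((hmon.measurable.sub_const c).mul hm.abs).aestronglyMeasurable
    · have h0 : 0 ≤ g z - c := by rw [hg]; simp
      rw [Real.norm_eq_abs, abs_mul, abs_abs, abs_of_nonneg h0]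
      calc (g z - c) * |h z| ≤ (g z - c) * (C * Real.exp (-k * z ^ 2)) :=
            mul_le_mul_of_nonneg_left (hb z) h0
        _ = _ := by ring

/-- The Gaussian weight is `μ`-integrable. -/
lemma weight_integrable (g : ℝ → ℝ) (hmon : Monotone g) (μ : Measure ℝ) [SigmaFinite μ]
    (c : ℝ) (hfin : ∀ z, μ (Set.Iic z) ≠ ⊤) (hg : ∀ z, g z = c + (μ (Set.Iic z)).toReal)
    (hL2 : Integrable (fun z => (g z) ^ 2) (gaussianReal 0 1)) (k : ℝ) (hk : 1 / 4 < k) :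
    Integrable (fun t => Real.exp (-k * t ^ 2)) μ := by
  obtain ⟨l, hl1, hl2⟩ := exists_between hk
  have hl0 : 0 < l := by linarith
  have hI := (prod_indicator_integrable g hmon μ c hfin hg hL2 l hl1
    (fun z => Real.exp (-l * z ^ 2)) (by fun_prop) 1 (by intro z; simp)).integral_prod_left
  -- lower bound for the inner integral
  obtain ⟨M, hM⟩ : ∃ M : ℝ, ∀ t z : ℝ, t ≤ z → z ≤ t + 1 → l * z ^ 2 ≤ k * t ^ 2 + M := by
    refine ⟨l + l ^ 2 / (k - l), fun t z h1 h2 => ?_⟩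
    have h3 : z ^ 2 ≤ t ^ 2 + (2 * |t| + 1) := by
      have : |z| ≤ |t| + 1 := by
        rw [abs_le]; constructor <;> cases abs_cases t <;> linarith
      rw [← sq_abs z, ← sq_abs t]; nlinarith [abs_nonneg z, abs_nonneg t]
    have h4 : 2 * l * |t| ≤ (k - l) * t ^ 2 + l ^ 2 / (k - l) := by
      have hd : 0 < k - l := by linarith
      have : (k - l) * t ^ 2 + l ^ 2 / (k - l) - 2 * l * |t| = ((k - l) * |t| - l) ^ 2 / (k - l) := by
        rw [← sq_abs t]; field_simp; ring
      have : 0 ≤ ((k - l) * |t| - l) ^ 2 / (k - l) := by positivity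
      linarith
    nlinarith
  refine (hI.const_mul (Real.exp M)).mono' (by fun_prop) (ae_of_all _ fun t => ?_)
  have hint : Integrable (fun z : ℝ => Real.exp (-l * z ^ 2)) := integrable_exp_neg_mul_sq hl0
  have key : Real.exp (-k * t ^ 2 - M) ≤ ∫ z, (Set.Ici t).indicator (fun z => Real.exp (-l * z ^ 2)) z := by
    calc Real.exp (-k * t ^ 2 - M)
        = ∫ z, (Set.Icc t (t + 1)).indicator (fun _ => Real.exp (-k * t ^ 2 - M)) z := by
          rw [integral_indicator measurableSet_Icc, setIntegral_const]
          simp [Measure.real]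
      _ ≤ _ := by
          refine integral_mono ?_ (hint.indicator measurableSet_Ici) fun z => ?_
          · rw [integrable_indicator_iff measurableSet_Icc]
            exact integrableOn_const (by simp)
          · by_cases hz : z ∈ Set.Icc t (t + 1)
            · rw [Set.indicator_of_mem hz, Set.indicator_of_mem (show z ∈ Set.Ici t from hz.1)]
              apply Real.exp_le_exp.2
              have := hM t z hz.1 hz.2
              linarith
            · rw [Set.indicator_of_notMem hz]
              exact Set.indicator_nonneg (fun _ _ => (Real.exp_pos _).le) _
  rw [Real.norm_eq_abs, Real.abs_exp]
  calc Real.exp (-k * t ^ 2) = Real.exp M * Real.exp (-k * t ^ 2 - M) := by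
        rw [← Real.exp_add]; congr 1; ring
    _ ≤ _ := mul_le_mul_of_nonneg_left key (Real.exp_pos _).le

lemma tendsto_zero_of_bound (h : ℝ → ℝ) (k C : ℝ) (hk : 0 < k) (L : Filter ℝ)
    (hL : Filter.Tendsto (fun z : ℝ => z ^ 2) L Filter.atTop)
    (hb : ∀ z, |h z| ≤ C * Real.exp (-k * z ^ 2)) : Filter.Tendsto h L (nhds 0) := by
  refine squeeze_zero_norm hb ?_
  have : Filter.Tendsto (fun z : ℝ => Real.exp (-k * z ^ 2)) L (nhds 0) := by
    refine Real.tendsto_exp_atBot.comp ?_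
    exact hL.const_mul_atTop_of_neg (by linarith)
  simpa using this.const_mul C

/-- Integration by parts against the Stieltjes measure. -/
lemma stieltjes_parts (g : ℝ → ℝ) (hmon : Monotone g) (μ : Measure ℝ) [SigmaFinite μ]
    (c : ℝ) (hfin : ∀ z, μ (Set.Iic z) ≠ ⊤) (hg : ∀ z, g z = c + (μ (Set.Iic z)).toReal)
    (hL2 : Integrable (fun z => (g z) ^ 2) (gaussianReal 0 1)) (k : ℝ) (hk : 1 / 4 < k)
    (H h : ℝ → ℝ) (hm : Measurable h) (C : ℝ) (hb : ∀ z, |h z| ≤ C * Real.exp (-k * z ^ 2))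
    (hB : ∀ z, |H z| ≤ C * Real.exp (-k * z ^ 2)) (hd : ∀ z, HasDerivAt H (h z) z) :
    ∫ z, g z * h z = - ∫ t, H t ∂μ := by
  have hP := prod_indicator_integrable g hmon μ c hfin hg hL2 k hk h hm C hb
  have hk0 : 0 < k := by linarith
  have hint : Integrable h :=
    ((integrable_exp_neg_mul_sq hk0).const_mul C).mono' hm.aestronglyMeasurable (ae_of_all _ hb)
  have htop : Filter.Tendsto H Filter.atTop (nhds 0) :=
    tendsto_zero_of_bound H k C hk0 _ (Filter.tendsto_pow_atTop (by norm_num)) hB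
  have hbot : Filter.Tendsto H Filter.atBot (nhds 0) :=
    tendsto_zero_of_bound H k C hk0 _ (by
      have := (Filter.tendsto_pow_atTop (α := ℝ) (n := 2) (by norm_num)).comp
        Filter.tendsto_neg_atBot_atTop
      refine this.congr fun z => by simp) hB
  have h0 : ∫ z, h z = 0 := by
    rw [integral_of_hasDerivAt_of_tendsto hd hint hbot htop]; simp
  have h1 : ∀ t, ∫ z, (Set.Ici t).indicator h z = - H t := by
    intro t
    rw [integral_indicator measurableSet_Ici, integral_Ici_eq_integral_Ioi,
      integral_Ioi_of_hasDerivAt_of_tendsto' (fun z _ => hd z) hint.integrableOn htop]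
    simp
  have h2 : ∀ z, ∫ t, (Set.Ici t).indicator h z ∂μ = g z * h z - c * h z := by
    intro z
    have hJ : ∀ x : ℝ, (Set.Ici x).indicator h z = (Set.Iic z).indicator (fun _ => h z) x := by
      intro x; simp [Set.indicator]
    simp_rw [hJ]
    rw [integral_indicator measurableSet_Iic, setIntegral_const, hg]
    simp [Measure.real]; ring
  have h3 := integral_integral_swap (μ := μ) (ν := volume)
    (f := fun t z => (Set.Ici t).indicator h z) hP
  simp_rw [h1, h2] at h3
  have hgh : Integrable (fun z => g z * h z) := by
    refine (((g_weight_integrable g hmon hL2 k hk).abs).const_mul C).mono'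
      (hmon.measurable.mul hm).aestronglyMeasurable (ae_of_all _ fun z => ?_)
    rw [Real.norm_eq_abs, abs_mul, abs_mul, Real.abs_exp]
    nlinarith [mul_le_mul_of_nonneg_left (hb z) (abs_nonneg (g z))]
  rw [integral_neg, integral_sub hgh (hint.const_mul c), integral_const_mul, h0] at h3
  linarith

/-- `∂_b φ₂`. -/
noncomputable def phi2b (a b r : ℝ) : ℝ := -((b - r * a) / (1 - r ^ 2)) * phi2 a b r

/-- `∂_a ∂_b φ₂ = ∂_ρ φ₂`. -/
noncomputable def phi2ab (a b r : ℝ) : ℝ :=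
  (r / (1 - r ^ 2) + (b - r * a) * (a - r * b) / (1 - r ^ 2) ^ 2) * phi2 a b r

lemma phi2_nonneg (a b r : ℝ) : 0 ≤ phi2 a b r := by unfold phi2; positivity

lemma phi2_deriv_b (a b r : ℝ) (hr : 0 < 1 - r ^ 2) :
    HasDerivAt (fun b => phi2 a b r) (phi2b a b r) b := by
  unfold phi2b phi2
  have h1 : HasDerivAt (fun b : ℝ => -(a ^ 2 - 2 * r * a * b + b ^ 2) / (2 * (1 - r ^ 2)))
      (-(-(2 * r * a) + 2 * b) / (2 * (1 - r ^ 2))) b := by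
    have := ((((hasDerivAt_id b).const_mul (2 * r * a)).const_sub (a ^ 2)).add
      ((hasDerivAt_id b).pow 2)).neg.div_const (2 * (1 - r ^ 2))
    exact this.congr_deriv (by simp)
  refine (h1.exp.const_mul ((2 * Real.pi * Real.sqrt (1 - r ^ 2))⁻¹)).congr_deriv ?_
  field_simp
  ring

lemma phi2_deriv_a (a b r : ℝ) (hr : 0 < 1 - r ^ 2) :
    HasDerivAt (fun a => phi2 a b r) (-((a - r * b) / (1 - r ^ 2)) * phi2 a b r) a := by
  have hs : ∀ x y, phi2 x y r = phi2 y x r := by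
    intro x y; unfold phi2; congr 3; ring
  have := phi2_deriv_b b a r hr
  unfold phi2b at this
  simp_rw [hs b] at this
  exact this

lemma phi2b_deriv_a (a b r : ℝ) (hr : 0 < 1 - r ^ 2) :
    HasDerivAt (fun a => phi2b a b r) (phi2ab a b r) a := by
  unfold phi2b phi2ab
  have h1 : HasDerivAt (fun a : ℝ => -((b - r * a) / (1 - r ^ 2))) (r / (1 - r ^ 2)) a := by
    have := ((((hasDerivAt_id a).const_mul r).const_sub b).div_const (1 - r ^ 2)).neg
    exact this.congr_deriv (by simp; ring)
  refine (h1.mul (phi2_deriv_a a b r hr)).congr_deriv ?_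
  field_simp

lemma phi2_deriv_r (a b r : ℝ) (hr : 0 < 1 - r ^ 2) :
    HasDerivAt (fun r => phi2 a b r) (phi2ab a b r) r := by
  unfold phi2ab phi2
  have hw : HasDerivAt (fun r : ℝ => 1 - r ^ 2) (-(2 * r)) r := by
    have := ((hasDerivAt_id r).pow 2).const_sub 1
    exact this.congr_deriv (by simp)
  have hN : HasDerivAt (fun r : ℝ => -(a ^ 2 - 2 * r * a * b + b ^ 2)) (2 * a * b) r := by
    have := (((((hasDerivAt_id r).const_mul 2).mul_const a).mul_const b).const_sub
      (a ^ 2)).add_const (b ^ 2) |>.neg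
    exact this.congr_deriv (by simp)
  have h1 := (hN.div (hw.const_mul 2) (by positivity)).exp
  have h2 := ((hw.sqrt hr.ne').const_mul (2 * Real.pi)).inv (by positivity)
  refine (h2.mul h1).congr_deriv ?_
  simp only [Pi.div_apply, Pi.inv_apply]
  have hs : 0 < √(1 - r ^ 2) := Real.sqrt_pos.2 hr
  have hs2 : √(1 - r ^ 2) ^ 2 = 1 - r ^ 2 := Real.sq_sqrt hr.le
  set w := √(1 - r ^ 2) with hwdef
  set E := Real.exp (-(a ^ 2 - 2 * r * a * b + b ^ 2) / (2 * (1 - r ^ 2)))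
  rw [← hs2]
  have hr2 : r ^ 2 = 1 - w ^ 2 := by linarith
  field_simp

  linear_combination (E * a * b) * hr2

set_option maxHeartbeats 1000000 in
lemma phi2_bound (R : ℝ) (hR0 : 0 ≤ R) (hR1 : R < 1) :
    ∃ k C : ℝ, 1 / 4 < k ∧ 0 ≤ C ∧ ∀ a b r : ℝ, |r| ≤ R →
      |phi2 a b r| ≤ C * (Real.exp (-k * a ^ 2) * Real.exp (-k * b ^ 2)) ∧
      |phi2b a b r| ≤ C * (Real.exp (-k * a ^ 2) * Real.exp (-k * b ^ 2)) ∧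
      |phi2ab a b r| ≤ C * (Real.exp (-k * a ^ 2) * Real.exp (-k * b ^ 2)) := by
  have hk0 : 1 / 4 < 1 / (2 * (1 + R)) := by
    rw [div_lt_div_iff₀ (by norm_num) (by positivity)]; linarith
  obtain ⟨k, hk1, hk2⟩ := exists_between hk0
  set k0 := 1 / (2 * (1 + R)) with hk0def
  have hW : 0 < 1 - R ^ 2 := by nlinarith
  have hW1 : 1 - R ^ 2 ≤ 1 := by nlinarith
  set W := 1 - R ^ 2 with hWdef
  set e := k0 - k with he
  have he0 : 0 < e := by linarith
  -- polynomial factor bound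
  refine ⟨k, (3 / W ^ 2 * (1 + 1 / e)) * (2 * Real.pi * √W)⁻¹, hk1, by positivity, ?_⟩
  intro a b r hr
  have hrR : r ^ 2 ≤ R ^ 2 := by rw [← sq_abs r]; nlinarith [abs_nonneg r]
  have hwW : W ≤ 1 - r ^ 2 := by linarith
  have hw0 : 0 < 1 - r ^ 2 := by linarith
  set S := a ^ 2 + b ^ 2 with hS
  have hS0 : 0 ≤ S := by positivity
  have hab : |a * b| ≤ S / 2 := by
    rw [abs_le]; constructor <;> nlinarith [sq_nonneg (a - b), sq_nonneg (a + b)]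
  -- bound on phi2
  have hphi : phi2 a b r ≤ (2 * Real.pi * √W)⁻¹ * Real.exp (-k0 * S) := by
    unfold phi2
    have hsq : √W ≤ √(1 - r ^ 2) := Real.sqrt_le_sqrt hwW
    have hsW : 0 < √W := Real.sqrt_pos.2 hW
    apply mul_le_mul _ _ (Real.exp_pos _).le (by positivity)
    · apply inv_anti₀ (by positivity)
      gcongr
    · apply Real.exp_le_exp.2
      have hr' : r * (a * b) ≤ |r| * (S / 2) := by
        calc r * (a * b) ≤ |r * (a * b)| := le_abs_self _
          _ = |r| * |a * b| := abs_mul _ _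
          _ ≤ _ := mul_le_mul_of_nonneg_left hab (abs_nonneg _)
      have h1 : k0 * S ≤ (a ^ 2 - 2 * r * a * b + b ^ 2) / (2 * (1 - r ^ 2)) := by
        rw [le_div_iff₀ (by positivity)]
        have h2 : k0 * (2 * (1 - r ^ 2)) ≤ 1 - |r| := by
          rw [hk0def, div_mul_eq_mul_div, div_le_iff₀ (by positivity), ← sq_abs r]
          nlinarith [abs_nonneg r, mul_nonneg (sub_nonneg.2 hr) (sub_nonneg.2 (hr.trans hR1.le))]
        nlinarith [mul_le_mul_of_nonneg_right h2 hS0]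
      rw [neg_div, neg_mul]
      linarith
  have hexp : (1 + S) * Real.exp (-k0 * S) ≤
      (1 + 1 / e) * (Real.exp (-k * a ^ 2) * Real.exp (-k * b ^ 2)) := by
    have h1 : Real.exp (-k * a ^ 2) * Real.exp (-k * b ^ 2) = Real.exp (-k0 * S) * Real.exp (e * S) := by
      rw [← Real.exp_add, ← Real.exp_add]; congr 1; rw [he, hS]; ring
    rw [h1]
    have h2 : 1 + S ≤ (1 + 1 / e) * Real.exp (e * S) := by
      have h3 := Real.add_one_le_exp (e * S)
      have h4 : 1 + S ≤ (1 + 1 / e) * (e * S + 1) := by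
        have : (1 + 1 / e) * (e * S + 1) = 1 + S + (e * S + 1 / e) := by field_simp; ring
        rw [this]
        have : 0 ≤ e * S + 1 / e := by positivity
        linarith
      exact h4.trans (mul_le_mul_of_nonneg_left h3 (by positivity))
    nlinarith [mul_le_mul_of_nonneg_left h2 (Real.exp_pos (-k0 * S)).le]
  -- general principle
  have gen : ∀ q : ℝ, |q| ≤ 3 / W ^ 2 * (1 + S) → |q * phi2 a b r| ≤
      (3 / W ^ 2 * (1 + 1 / e)) * (2 * Real.pi * √W)⁻¹ *
        (Real.exp (-k * a ^ 2) * Real.exp (-k * b ^ 2)) := by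
    intro q hq
    rw [abs_mul, abs_of_nonneg (phi2_nonneg a b r)]
    calc |q| * phi2 a b r ≤ (3 / W ^ 2 * (1 + S)) * ((2 * Real.pi * √W)⁻¹ * Real.exp (-k0 * S)) :=
          mul_le_mul hq hphi (phi2_nonneg a b r) (by positivity)
      _ = (3 / W ^ 2 * (2 * Real.pi * √W)⁻¹) * ((1 + S) * Real.exp (-k0 * S)) := by ring
      _ ≤ (3 / W ^ 2 * (2 * Real.pi * √W)⁻¹) *
          ((1 + 1 / e) * (Real.exp (-k * a ^ 2) * Real.exp (-k * b ^ 2))) :=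
          mul_le_mul_of_nonneg_left hexp (by positivity)
      _ = _ := by ring
  have hr1 : |r| ≤ 1 := by linarith
  have hWW : W ^ 2 ≤ W := by nlinarith
  have hba : |b - r * a| ≤ |a| + |b| := by
    calc |b - r * a| ≤ |b| + |r * a| := abs_sub _ _
      _ = |b| + |r| * |a| := by rw [abs_mul]
      _ ≤ _ := by nlinarith [abs_nonneg a]
  have hab' : |a - r * b| ≤ |a| + |b| := by
    calc |a - r * b| ≤ |a| + |r * b| := abs_sub _ _
      _ = |a| + |r| * |b| := by rw [abs_mul]
      _ ≤ _ := by nlinarith [abs_nonneg b]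
  have hsum : |a| + |b| ≤ 1 + S := by
    rw [hS, ← sq_abs a, ← sq_abs b]
    nlinarith [sq_nonneg (|a| - 1 / 2), sq_nonneg (|b| - 1 / 2)]
  have hsum2 : (|a| + |b|) ^ 2 ≤ 2 * S := by
    rw [hS, ← sq_abs a, ← sq_abs b]
    nlinarith [sq_nonneg (|a| - |b|)]
  refine ⟨?_, ?_, ?_⟩
  · have := gen 1 (by
      rw [abs_one, div_mul_eq_mul_div, le_div_iff₀ (by positivity)]
      nlinarith)
    simpa using this
  · apply gen
    rw [abs_neg, abs_div, abs_of_pos hw0]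
    calc |b - r * a| / (1 - r ^ 2) ≤ (1 + S) / W ^ 2 := by
          apply div_le_div₀ (by positivity) (hba.trans hsum) (by positivity) (by linarith)
      _ ≤ _ := by
          rw [div_mul_eq_mul_div]
          gcongr
          linarith
  · apply gen
    have h1 : |r / (1 - r ^ 2)| ≤ 1 / W ^ 2 := by
      rw [abs_div, abs_of_pos hw0]
      exact div_le_div₀ (by norm_num) hr1 (by positivity) (by linarith)
    have h2 : |(b - r * a) * (a - r * b) / (1 - r ^ 2) ^ 2| ≤ 2 * S / W ^ 2 := by
      rw [abs_div, abs_mul, abs_of_pos (pow_pos hw0 2)]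
      apply div_le_div₀ (by positivity) _ (by positivity) (by gcongr)
      calc |b - r * a| * |a - r * b| ≤ (|a| + |b|) * (|a| + |b|) := by gcongr
        _ = (|a| + |b|) ^ 2 := by ring
        _ ≤ _ := hsum2
    calc _ ≤ |r / (1 - r ^ 2)| + |(b - r * a) * (a - r * b) / (1 - r ^ 2) ^ 2| := abs_add_le _ _
      _ ≤ 1 / W ^ 2 + 2 * S / W ^ 2 := add_le_add h1 h2
      _ = (1 + 2 * S) / W ^ 2 := by ring
      _ ≤ _ := by
          rw [div_mul_eq_mul_div]
          gcongr
          linarith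

lemma measurable_phi2 (r : ℝ) : Measurable (fun p : ℝ × ℝ => phi2 p.1 p.2 r) := by
  unfold phi2; fun_prop

lemma measurable_phi2b (r : ℝ) : Measurable (fun p : ℝ × ℝ => phi2b p.1 p.2 r) := by
  unfold phi2b phi2; fun_prop

lemma measurable_phi2ab (r : ℝ) : Measurable (fun p : ℝ × ℝ => phi2ab p.1 p.2 r) := by
  unfold phi2ab phi2; fun_prop

/-- The derivative of the mixed moment. -/
lemma mixed_moment_hasDerivAt (gX gY : ℝ → ℝ)
    (hmonX : Monotone gX) (hmonY : Monotone gY)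
    (μX μY : Measure ℝ) (cX cY : ℝ)
    (hfinX : ∀ z, μX (Set.Iic z) ≠ ⊤) (hfinY : ∀ z, μY (Set.Iic z) ≠ ⊤)
    (hgX : ∀ z, gX z = cX + (μX (Set.Iic z)).toReal)
    (hgY : ∀ z, gY z = cY + (μY (Set.Iic z)).toReal)
    (hL2X : Integrable (fun z => (gX z) ^ 2) (gaussianReal 0 1))
    (hL2Y : Integrable (fun z => (gY z) ^ 2) (gaussianReal 0 1))
    (ρ : ℝ) (hρ : ρ ∈ Set.Ioo (-1 : ℝ) 1) :
    HasDerivAt (fun r => ∫ p : ℝ × ℝ, gX p.1 * gY p.2 * phi2 p.1 p.2 r)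
      (∫ t, (∫ s, phi2 t s ρ ∂μY) ∂μX) ρ := by
  have := sigmaFinite_of_Iic μX hfinX
  have := sigmaFinite_of_Iic μY hfinY
  have hab : |ρ| < 1 := abs_lt.2 hρ
  obtain ⟨R, hR1, hR2⟩ := exists_between hab
  have hR0 : 0 ≤ R := (abs_nonneg _).trans hR1.le
  obtain ⟨k, C, hk, hC, hbd⟩ := phi2_bound R hR0 hR2
  have hw : ∀ r, |r| ≤ R → 0 < 1 - r ^ 2 := by
    intro r hr; rw [← sq_abs]; nlinarith [abs_nonneg r]
  have hwρ := hw ρ hR1.le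
  have hexp1 : ∀ x : ℝ, Real.exp (-k * x ^ 2) ≤ 1 := fun x =>
    Real.exp_le_one_iff.2 (by nlinarith [sq_nonneg x])
  have hIX := g_weight_integrable gX hmonX hL2X k hk
  have hIY := g_weight_integrable gY hmonY hL2Y k hk
  have hmeasG : Measurable (fun p : ℝ × ℝ => gX p.1 * gY p.2) :=
    (hmonX.measurable.comp measurable_fst).mul (hmonY.measurable.comp measurable_snd)
  have hbound : Integrable (fun p : ℝ × ℝ => C * (|gX p.1 * Real.exp (-k * p.1 ^ 2)| *
      |gY p.2 * Real.exp (-k * p.2 ^ 2)|)) := (hIX.abs.mul_prod hIY.abs).const_mul C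
  have hle : ∀ (p : ℝ × ℝ) (q : ℝ),
      |q| ≤ C * (Real.exp (-k * p.1 ^ 2) * Real.exp (-k * p.2 ^ 2)) →
      ‖gX p.1 * gY p.2 * q‖ ≤ C * (|gX p.1 * Real.exp (-k * p.1 ^ 2)| *
      |gY p.2 * Real.exp (-k * p.2 ^ 2)|) := by
    intro p q hq
    simp only [Real.norm_eq_abs, abs_mul, Real.abs_exp]
    calc |gX p.1| * |gY p.2| * |q| ≤ |gX p.1| * |gY p.2| *
          (C * (Real.exp (-k * p.1 ^ 2) * Real.exp (-k * p.2 ^ 2))) := by gcongr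
      _ = _ := by ring
  obtain ⟨hint, hder⟩ := hasDerivAt_integral_of_dominated_loc_of_deriv_le
    (μ := (volume : Measure (ℝ × ℝ))) (x₀ := ρ) (s := Set.Ioo (-R) R)
    (F := fun r (p : ℝ × ℝ) => gX p.1 * gY p.2 * phi2 p.1 p.2 r)
    (F' := fun r (p : ℝ × ℝ) => gX p.1 * gY p.2 * phi2ab p.1 p.2 r)
    (Ioo_mem_nhds (abs_lt.1 hR1).1 (abs_lt.1 hR1).2)
    (Filter.Eventually.of_forall fun r => (hmeasG.mul (measurable_phi2 r)).aestronglyMeasurable)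
    (hbound.mono' (hmeasG.mul (measurable_phi2 ρ)).aestronglyMeasurable
      (ae_of_all _ fun p => hle p _ (hbd p.1 p.2 ρ hR1.le).1))
    (hmeasG.mul (measurable_phi2ab ρ)).aestronglyMeasurable
    (ae_of_all _ fun p r hr => hle p _ (hbd p.1 p.2 r (abs_lt.2 hr).le).2.2)
    hbound
    (ae_of_all _ fun p r hr =>
      (phi2_deriv_r p.1 p.2 r (hw r (abs_lt.2 hr).le)).const_mul _)
  refine hder.congr_deriv ?_
  -- first integration by parts
  have step1 : ∀ b, ∫ a, gX a * phi2ab a b ρ = - ∫ t, phi2b t b ρ ∂μX := by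
    intro b
    have hh : ∀ x : ℝ, C * (Real.exp (-k * x ^ 2) * Real.exp (-k * b ^ 2)) ≤
        C * Real.exp (-k * x ^ 2) := fun x =>
      mul_le_mul_of_nonneg_left
        (mul_le_of_le_one_right (Real.exp_pos _).le (hexp1 b)) hC
    exact stieltjes_parts gX hmonX μX cX hfinX hgX hL2X k hk (fun a => phi2b a b ρ)
      (fun a => phi2ab a b ρ) ((measurable_phi2ab ρ).comp (by fun_prop : Measurable fun a : ℝ => (a, b)))
      C (fun z => (hbd z b ρ hR1.le).2.2.trans (hh z)) (fun z => (hbd z b ρ hR1.le).2.1.trans (hh z))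
      (fun z => phi2b_deriv_a z b ρ hwρ)
  have step2 : ∀ t, ∫ b, gY b * phi2b t b ρ = - ∫ s, phi2 t s ρ ∂μY := by
    intro t
    have hh : ∀ x : ℝ, C * (Real.exp (-k * t ^ 2) * Real.exp (-k * x ^ 2)) ≤
        C * Real.exp (-k * x ^ 2) := fun x =>
      mul_le_mul_of_nonneg_left
        (mul_le_of_le_one_left (Real.exp_pos _).le (hexp1 t)) hC
    exact stieltjes_parts gY hmonY μY cY hfinY hgY hL2Y k hk (fun b => phi2 t b ρ)
      (fun b => phi2b t b ρ) ((measurable_phi2b ρ).comp (by fun_prop : Measurable fun b : ℝ => (t, b)))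
      C (fun z => (hbd t z ρ hR1.le).2.1.trans (hh z)) (fun z => (hbd t z ρ hR1.le).1.trans (hh z))
      (fun z => phi2_deriv_b t z ρ hwρ)
  have hswap : Integrable (Function.uncurry fun (b t : ℝ) => gY b * phi2b t b ρ)
      (volume.prod μX) := by
    have hEX := weight_integrable gX hmonX μX cX hfinX hgX hL2X k hk
    refine ((hIY.abs.mul_prod hEX).const_mul C).mono' ?_ (ae_of_all _ fun p => ?_)
    · exact ((hmonY.measurable.comp measurable_fst).mul
        ((measurable_phi2b ρ).comp measurable_swap)).aestronglyMeasurable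
    · simp only [Function.uncurry, Real.norm_eq_abs, abs_mul, Real.abs_exp]
      calc |gY p.1| * |phi2b p.2 p.1 ρ| ≤ |gY p.1| *
            (C * (Real.exp (-k * p.2 ^ 2) * Real.exp (-k * p.1 ^ 2))) := by
            gcongr
            exact (hbd p.2 p.1 ρ hR1.le).2.1
        _ = _ := by ring
  calc ∫ p : ℝ × ℝ, gX p.1 * gY p.2 * phi2ab p.1 p.2 ρ
      = ∫ b, ∫ a, gX a * gY b * phi2ab a b ρ := integral_prod_symm _ hint
    _ = ∫ b, -∫ t, gY b * phi2b t b ρ ∂μX := by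
        congr 1; ext b
        rw [integral_const_mul, ← mul_neg, ← step1, ← integral_const_mul]
        congr 1; ext a; ring
    _ = -∫ t, (∫ b, gY b * phi2b t b ρ) ∂μX := by
        rw [integral_neg, integral_integral_swap hswap]
    _ = _ := by
        simp_rw [step2]
        rw [integral_neg, neg_neg]

/-- For nondecreasing quantile transforms `g_X, g_Y` with Lebesgue–Stieltjes
representations `g(z) = c + μ(Iic z)`, the correlation map
`ψ(ρ) = Cor(g_X(Z₁), g_Y(Z₂)) = (σ_X σ_Y)⁻¹ (E[g_X(Z₁) g_Y(Z₂)] − m_X m_Y)`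
has derivative `ψ'(ρ) = (σ_X σ_Y)⁻¹ ∬ φ₂(t,s;ρ) dμ_X(t) dμ_Y(s) ≥ 0` on `(−1,1)`,
and hence `ψ` is nondecreasing on `(−1,1)`. -/
theorem psi_monotone_derivative (gX gY : ℝ → ℝ)
    (hmonX : Monotone gX) (hmonY : Monotone gY)
    (μX μY : Measure ℝ) (cX cY : ℝ)
    (hfinX : ∀ z, μX (Set.Iic z) ≠ ⊤) (hfinY : ∀ z, μY (Set.Iic z) ≠ ⊤)
    (hgX : ∀ z, gX z = cX + (μX (Set.Iic z)).toReal)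
    (hgY : ∀ z, gY z = cY + (μY (Set.Iic z)).toReal)
    (σX σY : ℝ) (hσX : 0 < σX) (hσY : 0 < σY)
    (hvX : variance gX (gaussianReal 0 1) = σX ^ 2)
    (hvY : variance gY (gaussianReal 0 1) = σY ^ 2)
    (hL2X : Integrable (fun z => (gX z) ^ 2) (gaussianReal 0 1))
    (hL2Y : Integrable (fun z => (gY z) ^ 2) (gaussianReal 0 1))
    (mX mY : ℝ)
    (hmX : mX = ∫ z, gX z ∂(gaussianReal 0 1))
    (hmY : mY = ∫ z, gY z ∂(gaussianReal 0 1))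
    (ψ : ℝ → ℝ)
    (hψ : ∀ ρ, ψ ρ =
      (σX * σY)⁻¹ * ((∫ p : ℝ × ℝ, gX p.1 * gY p.2 * phi2 p.1 p.2 ρ) - mX * mY)) :
    (∀ ρ ∈ Set.Ioo (-1 : ℝ) 1,
      HasDerivAt ψ ((σX * σY)⁻¹ * ∫ t, (∫ s, phi2 t s ρ ∂μY) ∂μX) ρ ∧
      0 ≤ (σX * σY)⁻¹ * ∫ t, (∫ s, phi2 t s ρ ∂μY) ∂μX) ∧
    MonotoneOn ψ (Set.Ioo (-1 : ℝ) 1) := by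
  have hd : ∀ ρ ∈ Set.Ioo (-1 : ℝ) 1,
      HasDerivAt ψ ((σX * σY)⁻¹ * ∫ t, (∫ s, phi2 t s ρ ∂μY) ∂μX) ρ ∧
      0 ≤ (σX * σY)⁻¹ * ∫ t, (∫ s, phi2 t s ρ ∂μY) ∂μX := by
    intro ρ hρ
    constructor
    · rw [funext hψ]
      exact ((mixed_moment_hasDerivAt gX gY hmonX hmonY μX μY cX cY hfinX hfinY hgX hgY
        hL2X hL2Y ρ hρ).sub_const (mX * mY)).const_mul _
    · exact mul_nonneg (by positivity)
        (integral_nonneg fun t => integral_nonneg fun s => phi2_nonneg t s ρ)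
  refine ⟨hd, ?_⟩
  refine monotoneOn_of_deriv_nonneg (convex_Ioo _ _)
    (fun ρ hρ => (hd ρ hρ).1.continuousAt.continuousWithinAt) ?_ ?_
  · rw [interior_Ioo]
    exact fun ρ hρ => (hd ρ hρ).1.differentiableAt.differentiableWithinAt
  · rw [interior_Ioo]
    intro ρ hρ
    rw [(hd ρ hρ).1.deriv]
    exact (hd ρ hρ).2
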